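/- For a simple graph G on n vertices, the number of spanning trees of the complement satisfies n · t(K_n − E(G)) = P(n, G), where P(λ, G) is defined by det(λI − L(G)) = λ·P(λ, G). -/

import Mathlib

/-- The number of spanning trees of a simple graph `G`: spanning subgraphs (on the same
vertex set) that are trees. -/
noncomputable def spanningTreeCount {V : Type*} (G : SimpleGraph V) : ℕ :=
  Set.ncard {T : SimpleGraph V | T ≤ G ∧ T.IsTree}

/-- The matrix of a map `f` rooted at `r`: the row of `r` is constant one, and the row of any
other vertex `v` is `e_v - e_{f v}`. -/
def rootedMatrix {V : Type*} [DecidableEq V] (r : V) (f : V → V) : Matrix V V ℝ :=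
  fun v => if v = r then 1 else Pi.single v 1 - Pi.single (f v) 1

theorem det_rootedMatrix_of_reach {V : Type*} [Fintype V] [DecidableEq V] {r : V} {f : V → V}
    (h : ∀ v, ∃ k, f^[k] v = r) : (rootedMatrix r f).det = Fintype.card V := by
  set N : Matrix V V ℝ :=
    fun v => if v = r then Pi.single r 1 else Pi.single v 1 - Pi.single (f v) 1 with hN
  set d : V → ℕ := fun v => Nat.find (h v) with hd
  have hlt : ∀ v, v ≠ r → d (f v) < d v := by
    intro v hv
    have hs : f^[d v] v = r := Nat.find_spec (h v)
    rcases hk : d v with _ | k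
    · rw [hk] at hs
      exact absurd hs hv
    · rw [hk, Function.iterate_succ_apply] at hs
      exact Nat.lt_succ_of_le (Nat.find_min' (h (f v)) hs)
  have htri : N.BlockTriangular (fun v => OrderDual.toDual (d v)) := by
    intro i j hij
    have hij' : d i < d j := hij
    have hne : j ≠ i := by rintro rfl; exact lt_irrefl _ hij'
    by_cases hi : i = r
    · subst hi
      simp [hN, hne]
    · have hf : j ≠ f i := by
        rintro rfl
        exact absurd (hlt i hi) (not_lt.2 hij'.le)
      simp [hN, hi, hne, hf]
  have hdet : N.det = 1 := by
    rw [htri.det]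
    refine Finset.prod_eq_one fun a _ => ?_
    have : N.toSquareBlock (fun v => OrderDual.toDual (d v)) a = 1 := by
      ext ⟨i, hi⟩ ⟨j, hj⟩
      have hij : d i = d j := OrderDual.toDual.injective (hi.trans hj.symm)
      simp only [Matrix.toSquareBlock_def, Matrix.of_apply, Matrix.one_apply, Subtype.mk.injEq]
      by_cases hir : i = r
      · subst hir
        simp [hN, Pi.single_apply, eq_comm]
      · have hf : j ≠ f i := by
          rintro rfl
          exact absurd (hlt i hir) (by omega)
        simp [hN, hir, Pi.single_apply, hf, eq_comm (a := i)]
    rw [this, Matrix.det_one]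
  have hone : N.mulVec 1 = Pi.single r 1 := by
    ext v
    by_cases hv : v = r
    · subst hv
      simp [hN, Matrix.mulVec]
    · change dotProduct (N v) 1 = _
      simp only [hN, hv, if_false]
      rw [sub_dotProduct]
      simp [hv]
  have hadj : N.adjugate.mulVec (Pi.single r 1) = 1 := by
    rw [← hone, Matrix.mulVec_mulVec, Matrix.adjugate_mul, hdet, one_smul, Matrix.one_mulVec]
  have hupd : rootedMatrix r f = N.updateRow r 1 := by
    ext i j
    by_cases hi : i = r
    · subst hi
      simp [rootedMatrix]
    · rw [Matrix.updateRow_ne hi]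
      simp only [rootedMatrix, hN, hi, if_false]
  have hcol : ∀ j, N.adjugate j r = 1 := fun j => by simpa using congrFun hadj j
  rw [hupd, ← Matrix.cramer_transpose_apply, Matrix.cramer_eq_adjugate_mulVec,
    ← Matrix.adjugate_transpose]
  simp [Matrix.mulVec, dotProduct, hcol]

theorem det_rootedMatrix_of_not_reach {V : Type*} [Fintype V] [DecidableEq V] {r : V} {f : V → V}
    (h : ¬ ∀ v, ∃ k, f^[k] v = r) : (rootedMatrix r f).det = 0 := by
  classical
  set S : Finset V := Finset.univ.filter fun v => ∃ k, f^[k] v = r with hS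
  have hrS : r ∈ S := by simpa [hS] using ⟨0, rfl⟩
  have hcard : S.card < Fintype.card V := by
    rw [Finset.card_lt_iff_ne_univ]
    intro hu
    exact h fun v => by
      have hv : v ∈ S := hu ▸ Finset.mem_univ v
      simpa [hS] using hv
  have hstep : ∀ v, v ≠ r → (f v ∈ S ↔ v ∈ S) := by
    intro v hv
    simp only [hS, Finset.mem_filter, Finset.mem_univ, true_and]
    constructor
    · rintro ⟨k, hk⟩
      exact ⟨k + 1, hk⟩
    · rintro ⟨_ | k, hk⟩
      · exact absurd hk hv
      · exact ⟨k, hk⟩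
  rw [← Matrix.exists_mulVec_eq_zero_iff]
  refine ⟨fun v => (Fintype.card V : ℝ) * (if v ∈ S then 1 else 0) - S.card, ?_, ?_⟩
  · intro h0
    have h1 := congrFun h0 r
    simp only [hrS, if_true, mul_one, Pi.zero_apply, sub_eq_zero, Nat.cast_inj] at h1
    omega
  · ext v
    by_cases hv : v = r
    · simp [Matrix.mulVec, rootedMatrix, hv, dotProduct, Finset.sum_sub_distrib, mul_comm]
    · rw [Matrix.mulVec]
      simp only [rootedMatrix, hv, if_false]
      rw [sub_dotProduct]
      simp [hstep v hv]

/-- The graph joining every vertex `v` to `f v`. -/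
def functionGraph {V : Type*} (f : V → V) : SimpleGraph V :=
  SimpleGraph.fromRel fun u v => f u = v

theorem functionGraph_adj {V : Type*} {f : V → V} {u v : V} :
    (functionGraph f).Adj u v ↔ u ≠ v ∧ (f u = v ∨ f v = u) :=
  SimpleGraph.fromRel_adj _ _ _

theorem functionGraph_reachable_iterate {V : Type*} (f : V → V) (v : V) (k : ℕ) :
    (functionGraph f).Reachable v (f^[k] v) := by
  induction k with
  | zero => rfl
  | succ k ih =>
    rw [Function.iterate_succ_apply']
    refine ih.trans ?_
    by_cases h : f^[k] v = f (f^[k] v)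
    · rw [← h]
    · exact SimpleGraph.Adj.reachable (functionGraph_adj.2 ⟨h, Or.inl rfl⟩)

theorem functionGraph_isTree {V : Type*} [Finite V] {r : V} {f : V → V} (hr : f r = r)
    (h : ∀ v, ∃ k, f^[k] v = r) : (functionGraph f).IsTree := by
  classical
  have := Fintype.ofFinite V
  have hreach : ∀ v, (functionGraph f).Reachable v r := by
    intro v
    obtain ⟨k, hk⟩ := h v
    exact hk ▸ functionGraph_reachable_iterate f v k
  have hconn : (functionGraph f).Connected :=
    { preconnected := fun u v => (hreach u).trans (hreach v).symm, nonempty := ⟨r⟩ }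
  rw [SimpleGraph.isTree_iff_connected_and_card]
  refine ⟨hconn, le_antisymm ?_ hconn.card_vert_le_card_edgeSet_add_one⟩
  have hsub : (functionGraph f).edgeSet ⊆
      ((Finset.univ.erase r).image fun v => s(v, f v) : Finset (Sym2 V)) := by
    intro e
    induction e with
    | _ u v =>
      intro he
      obtain ⟨hne, huv⟩ := functionGraph_adj.1 he
      rw [Finset.mem_coe, Finset.mem_image]
      rcases huv with huv | huv
      · exact ⟨u, Finset.mem_erase.2 ⟨by rintro rfl; exact hne (hr ▸ huv), Finset.mem_univ _⟩,
          by rw [huv]⟩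
      · exact ⟨v, Finset.mem_erase.2 ⟨by rintro rfl; exact hne (huv.symm.trans hr),
          Finset.mem_univ _⟩, by rw [huv, Sym2.eq_swap]⟩
  have hle : Nat.card (functionGraph f).edgeSet ≤ Fintype.card V - 1 := by
    calc Nat.card (functionGraph f).edgeSet ≤ _ := Nat.card_mono (Finset.finite_toSet _) hsub
      _ ≤ (Finset.univ.erase r).card := by
        rw [Nat.card_coe_set_eq, Set.ncard_coe_finset]
        exact Finset.card_image_le
      _ = _ := by rw [Finset.card_erase_of_mem (Finset.mem_univ _), Finset.card_univ]
  have hpos : 0 < Fintype.card V := Fintype.card_pos_iff.2 ⟨r⟩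
  rw [Nat.card_eq_fintype_card (α := V)]
  omega

theorem eq_of_functionGraph_eq {V : Type*} {r : V} {f g : V → V} (hf : f r = r) (hg : g r = r)
    (hreach : ∀ v, ∃ k, f^[k] v = r) (hne : ∀ v, v ≠ r → v ≠ f v)
    (h : functionGraph f = functionGraph g) : f = g := by
  have key : ∀ k v, f^[k] v = r → f v = g v := by
    intro k
    induction k with
    | zero =>
      rintro v rfl
      exact hf.trans hg.symm
    | succ k ih =>
      intro v hk
      by_cases hv : v = r
      · rw [hv, hf, hg]
      have hadj : (functionGraph g).Adj v (f v) :=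
        h ▸ functionGraph_adj.2 ⟨hne v hv, Or.inl rfl⟩
      rcases (functionGraph_adj.1 hadj).2 with h1 | h1
      · exact h1.symm
      · have h2 : f (f v) = v := (ih (f v) hk).trans h1
        have h3 : ∀ m, f^[m] v = v ∨ f^[m] v = f v := by
          intro m
          induction m with
          | zero => exact Or.inl rfl
          | succ m hm =>
            rw [Function.iterate_succ_apply']
            rcases hm with hm | hm
            · exact Or.inr (by rw [hm])
            · exact Or.inl (by rw [hm, h2])
        obtain ⟨m, hm⟩ := hreach v
        rcases h3 m with h4 | h4
        · exact absurd (h4.symm.trans hm) hv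
        · have h5 : f v = r := h4.symm.trans hm
          exact absurd (by rw [← h2, h5, hf]) hv
  funext v
  obtain ⟨k, hk⟩ := hreach v
  exact key k v hk

theorem exists_functionGraph_eq {V : Type*} [Finite V] {T : SimpleGraph V} (hT : T.IsTree)
    (r : V) : ∃ f : V → V, f r = r ∧ (∀ v, v ≠ r → T.Adj v (f v)) ∧
      (∀ v, ∃ k, f^[k] v = r) ∧ functionGraph f = T := by
  classical
  have := Fintype.ofFinite V
  have hex : ∀ v, ∃ u, (v = r → u = r) ∧ (v ≠ r → T.Adj v u ∧ T.dist u r < T.dist v r) := by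
    intro v
    by_cases hv : v = r
    · exact ⟨r, fun _ => rfl, fun h => absurd hv h⟩
    obtain ⟨w, hw⟩ := hT.connected.exists_walk_length_eq_dist v r
    cases w with
    | nil => exact absurd rfl hv
    | cons hadj p =>
      refine ⟨_, fun h => absurd h hv, fun _ => ⟨hadj, ?_⟩⟩
      rw [← hw, SimpleGraph.Walk.length_cons]
      exact Nat.lt_succ_of_le (SimpleGraph.dist_le p)
  choose f hf using hex
  have hreach : ∀ n v, T.dist v r ≤ n → ∃ k, f^[k] v = r := by
    intro n
    induction n with
    | zero =>
      intro v hv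
      exact ⟨0, (hT.connected.dist_eq_zero_iff).1 (Nat.le_zero.1 hv)⟩
    | succ n ih =>
      intro v hv
      by_cases hvr : v = r
      · exact ⟨0, hvr⟩
      · obtain ⟨k, hk⟩ := ih (f v) (by have := ((hf v).2 hvr).2; omega)
        exact ⟨k + 1, hk⟩
  have hr : f r = r := (hf r).1 rfl
  have hall : ∀ v, ∃ k, f^[k] v = r := fun v => hreach _ v le_rfl
  refine ⟨f, hr, fun v hv => ((hf v).2 hv).1, hall, ?_⟩
  have hle : functionGraph f ≤ T := by
    intro u v huv
    obtain ⟨hne, h | h⟩ := functionGraph_adj.1 huv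
    · subst h
      exact ((hf u).2 (by rintro rfl; exact hne hr.symm)).1
    · subst h
      exact ((hf v).2 (by rintro rfl; exact hne hr)).1.symm
  have htree := functionGraph_isTree hr hall
  have h1 := (SimpleGraph.isTree_iff_connected_and_card.1 htree).2
  have h2 := (SimpleGraph.isTree_iff_connected_and_card.1 hT).2
  rw [← SimpleGraph.edgeSet_inj]
  refine Set.eq_of_subset_of_ncard_le (SimpleGraph.edgeSet_subset_edgeSet.2 hle) ?_
    (Set.toFinite _)
  simp only [← Nat.card_coe_set_eq]
  omega

/-- The spanning trees of `H` correspond to the maps sending each non-root vertex to a neighbour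
from which the root can eventually be reached. -/
theorem spanningTreeCount_eq_card {V : Type*} [Fintype V] [DecidableEq V] (H : SimpleGraph V)
    [DecidableRel H.Adj] (r : V) [DecidablePred fun f : V → V => ∀ v, ∃ k, f^[k] v = r] :
    spanningTreeCount H =
      ((Fintype.piFinset fun v => if v = r then {r} else H.neighborFinset v).filter
        fun f => ∀ v, ∃ k, f^[k] v = r).card := by
  have hmem : ∀ f : V → V,
      f ∈ Fintype.piFinset (fun v => if v = r then {r} else H.neighborFinset v) ↔
        f r = r ∧ ∀ v, v ≠ r → H.Adj v (f v) := by
    intro f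
    rw [Fintype.mem_piFinset]
    constructor
    · intro h
      exact ⟨by simpa using h r, fun v hv => by simpa [hv] using h v⟩
    · rintro ⟨h1, h2⟩ v
      by_cases hv : v = r
      · subst hv
        simpa using h1
      · simpa [hv] using h2 v hv
  rw [spanningTreeCount, ← Set.ncard_coe_finset]
  symm
  refine Set.ncard_congr (fun f _ => functionGraph f) ?_ ?_ ?_
  · intro f hf
    rw [Finset.mem_coe, Finset.mem_filter, hmem] at hf
    obtain ⟨⟨hr, hadj⟩, hreach⟩ := hf
    refine ⟨?_, functionGraph_isTree hr hreach⟩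
    intro u v huv
    obtain ⟨hne, h | h⟩ := functionGraph_adj.1 huv
    · subst h
      exact hadj u (by rintro rfl; exact hne hr.symm)
    · subst h
      exact (hadj v (by rintro rfl; exact hne hr)).symm
  · intro f g hf hg hfg
    rw [Finset.mem_coe, Finset.mem_filter, hmem] at hf hg
    exact eq_of_functionGraph_eq hf.1.1 hg.1.1 hf.2 (fun v hv => (hf.1.2 v hv).ne) hfg
  · rintro T ⟨hTH, hT⟩
    obtain ⟨f, hr, hadj, hreach, rfl⟩ := exists_functionGraph_eq hT r
    refine ⟨f, ?_, rfl⟩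
    rw [Finset.mem_coe, Finset.mem_filter, hmem]
    exact ⟨⟨hr, fun v hv => hTH (hadj v hv)⟩, hreach⟩

theorem lapMatrix_row_eq_sum {V : Type*} [Fintype V] [DecidableEq V] (H : SimpleGraph V)
    [DecidableRel H.Adj] (v : V) :
    H.lapMatrix ℝ v =
      ∑ u ∈ H.neighborFinset v, (Pi.single v 1 - Pi.single u 1 : V → ℝ) := by
  ext w
  simp [SimpleGraph.lapMatrix, SimpleGraph.degMatrix, Matrix.diagonal_apply, Pi.single_apply,
    SimpleGraph.adjMatrix_apply, Finset.sum_apply, Finset.sum_sub_distrib, eq_comm]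

theorem det_lapMatrix_updateRow_one {V : Type*} [Fintype V] [DecidableEq V] (H : SimpleGraph V)
    [DecidableRel H.Adj] (r : V) :
    ((H.lapMatrix ℝ).updateRow r 1).det = Fintype.card V * spanningTreeCount H := by
  classical
  have hrow : (H.lapMatrix ℝ).updateRow r 1 = fun v =>
      ∑ u ∈ (if v = r then {r} else H.neighborFinset v),
        (if v = r then 1 else Pi.single v 1 - Pi.single u 1 : V → ℝ) := by
    funext v
    by_cases hv : v = r
    · subst hv
      simp
    · simp only [hv, if_false]
      rw [← lapMatrix_row_eq_sum]
      exact Matrix.updateRow_ne hv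
  have hexp := (Matrix.detRowAlternating (n := V) (R := ℝ)).toMultilinearMap.map_sum_finset
    (fun v u => (if v = r then 1 else Pi.single v 1 - Pi.single u 1 : V → ℝ))
    (fun v => if v = r then {r} else H.neighborFinset v)
  rw [hrow]
  refine hexp.trans ?_
  rw [spanningTreeCount_eq_card H r, Finset.card_filter, Nat.cast_sum, Finset.mul_sum]
  refine Finset.sum_congr rfl fun f _ => ?_
  change (rootedMatrix r f).det = _
  split_ifs with h
  · simp [det_rootedMatrix_of_reach h]
  · simp [det_rootedMatrix_of_not_reach h]

theorem det_lapMatrix_add_one {V : Type*} [Fintype V] [DecidableEq V] [Nonempty V]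
    (H : SimpleGraph V) [DecidableRel H.Adj] :
    (H.lapMatrix ℝ + Matrix.of fun _ _ => 1).det =
      (Fintype.card V : ℝ) ^ 2 * spanningTreeCount H := by
  obtain ⟨r⟩ := ‹Nonempty V›
  set M : Matrix V V ℝ := H.lapMatrix ℝ + Matrix.of fun _ _ => 1 with hM
  have hcol : ∀ j, ∑ i, H.lapMatrix ℝ i j = 0 := by
    intro j
    have h := congrFun (H.lapMatrix_mulVec_const_eq_zero (R := ℝ)) j
    simp only [Matrix.mulVec, dotProduct, mul_one, Pi.zero_apply] at h
    rw [← h]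
    exact Finset.sum_congr rfl fun i _ => (H.isSymm_lapMatrix (R := ℝ)).apply j i
  have hsum : ∑ k, (1 : ℝ) • M k = (Fintype.card V : ℝ) • (1 : V → ℝ) := by
    ext j
    rw [Finset.sum_apply]
    simp [hM, Finset.sum_add_distrib, hcol]
  have h1 := Matrix.det_updateRow_sum M r (fun _ => (1 : ℝ))
  rw [hsum, Matrix.det_updateRow_smul, one_smul] at h1
  have h2 : (M.updateRow r 1).det = ((H.lapMatrix ℝ).updateRow r 1).det := by
    refine Matrix.det_eq_of_forall_row_eq_smul_add_const (fun v => if v = r then 0 else 1) r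
      (by simp) fun i j => ?_
    by_cases hi : i = r
    · subst hi
      simp
    · simp [hi, hM]
  rw [← h1, h2, det_lapMatrix_updateRow_one]
  ring

theorem scalar_sub_lapMatrix {V : Type*} [Fintype V] [DecidableEq V] (G : SimpleGraph V)
    [DecidableRel G.Adj] :
    Matrix.scalar V (Fintype.card V : ℝ) - G.lapMatrix ℝ =
      Gᶜ.lapMatrix ℝ + Matrix.of fun _ _ => 1 := by
  ext i j
  by_cases hij : i = j
  · subst hij
    have h := G.degree_compl i
    have h' := G.degree_lt_card_verts i
    have h'' : (Gᶜ.degree i : ℝ) + 1 + G.degree i = Fintype.card V := by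
      norm_cast
      omega
    simp only [Matrix.sub_apply, Matrix.add_apply, Matrix.scalar_apply, Matrix.diagonal_apply_eq,
      SimpleGraph.lapMatrix, SimpleGraph.degMatrix, SimpleGraph.adjMatrix_apply,
      SimpleGraph.irrefl, if_false, Matrix.of_apply]
    linarith
  · rw [Matrix.sub_apply, Matrix.scalar_apply, Matrix.diagonal_apply_ne _ hij]
    by_cases hadj : G.Adj i j <;>
      simp [SimpleGraph.lapMatrix, SimpleGraph.degMatrix, hij, hadj]

/-- For a simple graph `G` on `n` vertices, `n · t(K_n − E(G)) = P(n, G)`, where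
`P(λ, G)` is defined by `det(λI − L(G)) = λ · P(λ, G)` and `K_n − E(G) = Gᶜ`. -/
theorem treeCount_compl_eq_eval {n : ℕ} (G : SimpleGraph (Fin n)) [DecidableRel G.Adj]
    (p : Polynomial ℝ) (hp : (G.lapMatrix ℝ).charpoly = Polynomial.X * p) :
    (n : ℝ) * (spanningTreeCount Gᶜ : ℝ) = p.eval (n : ℝ) := by
  rcases Nat.eq_zero_or_pos n with rfl | hn
  · have h := congrArg (Polynomial.eval 0) hp
    simp [Matrix.charpoly] at h
  have : Nonempty (Fin n) := ⟨⟨0, hn⟩⟩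
  have h := congrArg (Polynomial.eval (n : ℝ)) hp
  have hs := scalar_sub_lapMatrix G
  rw [Fintype.card_fin] at hs
  rw [Matrix.eval_charpoly, hs, det_lapMatrix_add_one, Fintype.card_fin, Polynomial.eval_mul,
    Polynomial.eval_X] at h
  have hn' : (n : ℝ) ≠ 0 := by positivity
  apply mul_left_cancel₀ hn'
  rw [← h]
  ring
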